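/- arXiv:2008.11268 — 3 statements merged into one kernel-verified Lean document; each statement's English description precedes it below -/
import Mathlib

section
/- Let h be a minimal vanishing sorou of weight 6 whose order equals its relative order. Then either exactly 4 elements of h have odd order and exactly 2 have even order, or exactly 2 elements have odd order and exactly 4 have even order; moreover, both possibilities occur for suitable h. -/
open Complex

noncomputable def nu (n : ℕ) : ℂ := Complex.exp (2 * Real.pi * Complex.I / n)

def IsRootOfUnity (z : ℂ) : Prop := ∃ n : ℕ, 0 < n ∧ z ^ n = 1

def IsSorou (h : Multiset ℂ) : Prop := h ≠ 0 ∧ ∀ z ∈ h, IsRootOfUnity z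

noncomputable def rootOrder (z : ℂ) : ℕ := sInf {d : ℕ | 0 < d ∧ z ^ d = 1}

noncomputable def sorouOrder (h : Multiset ℂ) : ℕ := (h.map rootOrder).lcm

noncomputable def relOrder (h : Multiset ℂ) : ℕ :=
  (h.bind fun a => h.map fun b => rootOrder (a / b)).lcm

def IsMinVanishing (h : Multiset ℂ) : Prop :=
  h.sum = 0 ∧ ∀ g : Multiset ℂ, g ≤ h → g ≠ 0 → g ≠ h → g.sum ≠ 0

open scoped Classical in
noncomputable def oddOrderCount (h : Multiset ℂ) : ℕ :=
  (h.filter fun z => Odd (rootOrder z)).card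

open scoped Classical in
noncomputable def evenOrderCount (h : Multiset ℂ) : ℕ :=
  (h.filter fun z => Even (rootOrder z)).card

theorem rootOrder_eq_orderOf {z : ℂ} (hz : IsRootOfUnity z) : rootOrder z = orderOf z := by
  have hmem : rootOrder z ∈ {d : ℕ | 0 < d ∧ z ^ d = 1} := Nat.sInf_mem hz
  have hpos : 0 < orderOf z := by
    obtain ⟨n, hn, h⟩ := hz
    exact (isOfFinOrder_iff_pow_eq_one.2 ⟨n, hn, h⟩).orderOf_pos
  exact le_antisymm (Nat.sInf_le ⟨hpos, pow_orderOf_eq_one z⟩)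
    (Nat.le_of_dvd hmem.1 (orderOf_dvd_of_pow_eq_one hmem.2))

theorem IsRootOfUnity.div {a b : ℂ} (ha : IsRootOfUnity a) (hb : IsRootOfUnity b) :
    IsRootOfUnity (a / b) := by
  obtain ⟨m, hm, ha⟩ := ha
  obtain ⟨n, hn, hb⟩ := hb
  refine ⟨m * n, by positivity, ?_⟩
  rw [div_pow, pow_mul, ha, mul_comm, pow_mul, hb]
  simp

theorem IsSorou.sorouOrder_dvd_iff {h : Multiset ℂ} (hh : IsSorou h) (n : ℕ) :
    sorouOrder h ∣ n ↔ ∀ z ∈ h, z ^ n = 1 := by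
  simp only [sorouOrder, Multiset.lcm_dvd, Multiset.mem_map, forall_exists_index, and_imp,
    forall_apply_eq_imp_iff₂]
  refine forall₂_congr fun z hz => ?_
  rw [rootOrder_eq_orderOf (hh.2 z hz), orderOf_dvd_iff_pow_eq_one]

theorem IsSorou.relOrder_dvd_iff {h : Multiset ℂ} (hh : IsSorou h) (n : ℕ) :
    relOrder h ∣ n ↔ ∀ a ∈ h, ∀ b ∈ h, (a / b) ^ n = 1 := by
  simp only [relOrder, Multiset.lcm_dvd, Multiset.mem_bind, Multiset.mem_map,
    forall_exists_index, and_imp]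
  constructor
  · intro H a ha b hb
    rw [← orderOf_dvd_iff_pow_eq_one,
      ← rootOrder_eq_orderOf ((hh.2 a ha).div (hh.2 b hb))]
    exact H _ a ha b hb rfl
  · rintro H _ a ha b hb rfl
    rw [rootOrder_eq_orderOf ((hh.2 a ha).div (hh.2 b hb)), orderOf_dvd_iff_pow_eq_one]
    exact H a ha b hb

theorem IsSorou.sorouOrder_pos {h : Multiset ℂ} (hh : IsSorou h) : 0 < sorouOrder h := by
  rw [Nat.pos_iff_ne_zero, sorouOrder, Ne, Multiset.lcm_eq_zero_iff, Multiset.mem_map]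
  rintro ⟨z, hz, h0⟩
  have hmem : rootOrder z ∈ {d : ℕ | 0 < d ∧ z ^ d = 1} := Nat.sInf_mem (hh.2 z hz)
  exact hmem.1.ne' h0

/-- Galois conjugation `ζ ↦ ζ ^ a` preserves vanishing of sums of `N`-th roots of unity. -/
theorem sum_map_pow_eq_zero {h : Multiset ℂ} {N a : ℕ} (hN : 0 < N)
    (hh : ∀ z ∈ h, z ^ N = 1) (hs : h.sum = 0) (ha : a.Coprime N) :
    (h.map (· ^ a)).sum = 0 := by
  have : NeZero N := ⟨hN.ne'⟩
  have hζ := Complex.isPrimitiveRoot_exp N hN.ne'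
  set ζ := Complex.exp (2 * Real.pi * Complex.I / N) with hζdef
  have hidx : ∀ z : ℂ, ∃ i : ℕ, z ∈ h → ζ ^ i = z := by
    intro z
    by_cases hz : z ∈ h
    · obtain ⟨i, -, hi⟩ := hζ.eq_pow_of_pow_eq_one (hh z hz)
      exact ⟨i, fun _ => hi⟩
    · exact ⟨0, fun h' => absurd h' hz⟩
  choose idx hidx using hidx
  let P : Polynomial ℤ := (h.map fun z => (Polynomial.X : Polynomial ℤ) ^ idx z).sum
  have haeval (w : ℂ) : Polynomial.aeval w P = (h.map fun z => w ^ idx z).sum := by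
    simp only [P, map_multiset_sum, Multiset.map_map, Function.comp_def, map_pow,
      Polynomial.aeval_X]
  have h0 : Polynomial.aeval ζ P = 0 := by
    rw [haeval, Multiset.map_congr rfl fun z hz => hidx z hz, Multiset.map_id', hs]
  have hdvd := minpoly.isIntegrallyClosed_dvd (hζ.isIntegral hN) h0
  rw [hζ.minpoly_eq_pow_coprime ha] at hdvd
  obtain ⟨Q, hQ⟩ := hdvd
  have h1 : Polynomial.aeval (ζ ^ a) P = 0 := by
    rw [hQ, map_mul, minpoly.aeval, zero_mul]
  rw [haeval] at h1
  rw [← h1]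
  congr 1
  refine Multiset.map_congr rfl fun z hz => ?_
  rw [← pow_mul, mul_comm, pow_mul, hidx z hz]

open scoped Classical in
/-- Fourier inversion over the classes of the map `z ↦ z ^ M` to `p`-th roots of unity. -/
theorem mul_sum_filter_pow_eq {h : Multiset ℂ} {p M : ℕ} (hp : p.Prime)
    (hh : ∀ z ∈ h, z ^ (p * M) = 1) {t : ℂ} (ht : t ^ p = 1) :
    (p : ℂ) * (h.filter (fun z => z ^ M = t)).sum =
      ∑ k ∈ Finset.range p, t⁻¹ ^ k * (h.map fun z => z * (z ^ M) ^ k).sum := by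
  have ht0 : t ≠ 0 := by rintro rfl; simp [hp.ne_zero] at ht
  induction h using Multiset.induction with
  | empty => simp
  | cons z h ih =>
    have ih := ih fun w hw => hh w (Multiset.mem_cons_of_mem hw)
    have hz := hh z (Multiset.mem_cons_self z h)
    have key : ∑ k ∈ Finset.range p, t⁻¹ ^ k * (z * (z ^ M) ^ k) =
        if z ^ M = t then p * z else 0 := by
      have e : ∀ k, t⁻¹ ^ k * (z * (z ^ M) ^ k) = z * (z ^ M / t) ^ k := by
        intro k; rw [div_eq_mul_inv, mul_pow]; ring
      simp only [e, ← Finset.mul_sum]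
      split_ifs with hzt
      · rw [hzt, div_self ht0]; simp [mul_comm]
      · have h1 : z ^ M / t ≠ 1 := by rwa [Ne, div_eq_one_iff_eq ht0]
        rw [geom_sum_eq h1, div_pow, ← pow_mul, mul_comm M, hz, ht]
        simp
    simp only [Multiset.map_cons, Multiset.sum_cons, mul_add, Finset.sum_add_distrib, key, ← ih]
    by_cases hzt : z ^ M = t
    · simp [hzt, mul_add]
    · simp [hzt]

open scoped Classical in
/-- In a vanishing sum of `p * M`-th roots of unity, the sums over the classes of `z ↦ z ^ M`
are all equal up to twisting by `p`-th roots of unity, and zero if `p ∣ M`. -/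
theorem exists_mul_sum_filter_pow_eq {h : Multiset ℂ} {p M : ℕ} (hp : p.Prime) (hM : 0 < M)
    (hh : ∀ z ∈ h, z ^ (p * M) = 1) (hs : h.sum = 0) :
    ∃ (k : ℕ) (D : ℂ), (p ∣ M → D = 0) ∧ ∀ t : ℂ, t ^ p = 1 →
      (p : ℂ) * (h.filter (fun z => z ^ M = t)).sum = t⁻¹ ^ k * D := by
  have hvanish : ∀ k, ¬ p ∣ 1 + k * M → (h.map fun z => z * (z ^ M) ^ k).sum = 0 := by
    intro k hk
    have hc : (1 + k * M).Coprime (p * M) := by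
      refine Nat.Coprime.mul_right ?_ ?_
      · exact ((Nat.Prime.coprime_iff_not_dvd hp).2 hk).symm
      · simp
    have := sum_map_pow_eq_zero (Nat.mul_pos hp.pos hM) hh hs hc
    rw [← this]
    congr 1
    refine Multiset.map_congr rfl fun z _ => ?_
    rw [pow_add, pow_one, mul_comm k, pow_mul]
  by_cases hex : ∃ k, k < p ∧ p ∣ 1 + k * M
  · obtain ⟨k, hkp, hk⟩ := hex
    have hpM : ¬ p ∣ M := by
      intro hpM
      have : p ∣ 1 := (Nat.dvd_add_left (hpM.mul_left k)).1 hk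
      exact hp.one_lt.ne' (Nat.dvd_one.1 this)
    refine ⟨k, (h.map fun z => z * (z ^ M) ^ k).sum, fun h' => absurd h' hpM, fun t ht => ?_⟩
    rw [mul_sum_filter_pow_eq hp hh ht]
    refine Finset.sum_eq_single_of_mem k (Finset.mem_range.2 hkp) fun j hj hjk => ?_
    rw [hvanish j, mul_zero]
    intro hj'
    have hd : (p : ℤ) ∣ ((j : ℤ) - k) * M := by
      have h1 : (p : ℤ) ∣ 1 + j * M := by exact_mod_cast hj'
      have h2 : (p : ℤ) ∣ 1 + k * M := by exact_mod_cast hk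
      have e : ((j : ℤ) - k) * M = (1 + j * M) - (1 + k * M) := by ring
      rw [e]
      exact dvd_sub h1 h2
    have hpz : Prime (p : ℤ) := Nat.prime_iff_prime_int.1 hp
    rcases hpz.dvd_or_dvd hd with h1 | h1
    · have hjp := Finset.mem_range.1 hj
      have := Int.eq_zero_of_abs_lt_dvd h1 (by rw [abs_lt]; constructor <;> omega)
      omega
    · exact hpM (by exact_mod_cast h1)
  · refine ⟨0, 0, fun _ => rfl, fun t ht => ?_⟩
    rw [mul_sum_filter_pow_eq hp hh ht, mul_zero]
    refine Finset.sum_eq_zero fun j hj => ?_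
    rw [hvanish j (fun hj' => hex ⟨j, Finset.mem_range.1 hj, hj'⟩), mul_zero]

open scoped Classical in
/-- For a prime `p` dividing the order of a minimal vanishing sorou whose order is its relative
order, the class sums of `exists_mul_sum_filter_pow_eq` do not vanish. -/
theorem IsMinVanishing.exists_mul_sum_filter_pow_eq {h : Multiset ℂ} (hh : IsSorou h)
    (hm : IsMinVanishing h) (ho : sorouOrder h = relOrder h) {p M : ℕ} (hp : p.Prime)
    (hM : sorouOrder h = p * M) :
    ¬ p ∣ M ∧ ∃ (k : ℕ) (D : ℂ), D ≠ 0 ∧ ∀ t : ℂ, t ^ p = 1 →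
      (p : ℂ) * (h.filter (fun z => z ^ M = t)).sum = t⁻¹ ^ k * D := by
  have hNpos := hh.sorouOrder_pos
  have hMpos : 0 < M := Nat.pos_of_ne_zero (by rintro rfl; omega)
  have hpow : ∀ z ∈ h, z ^ (p * M) = 1 := (hh.sorouOrder_dvd_iff _).1 hM.dvd
  obtain ⟨k, D, hD, H⟩ := _root_.exists_mul_sum_filter_pow_eq hp hMpos hpow hm.1
  have hD0 : D ≠ 0 := by
    intro hD0
    obtain ⟨z, hz⟩ := Multiset.exists_mem_of_ne_zero hh.1
    have hzero : (h.filter (fun w => w ^ M = z ^ M)).sum = 0 := by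
      have := H (z ^ M) (by rw [← pow_mul, mul_comm, hpow z hz])
      rw [hD0, mul_zero, mul_eq_zero] at this
      exact this.resolve_left (by exact_mod_cast hp.ne_zero)
    have hall : h.filter (fun w => w ^ M = z ^ M) = h := by
      by_contra hne
      refine hm.2 _ (Multiset.filter_le _ h) (fun h0 => ?_) hne hzero
      have : z ∈ h.filter (fun w => w ^ M = z ^ M) := Multiset.mem_filter.2 ⟨hz, rfl⟩
      rw [h0] at this
      exact Multiset.notMem_zero _ this
    have hall' := Multiset.filter_eq_self.1 hall
    have hdvd : relOrder h ∣ M := by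
      rw [hh.relOrder_dvd_iff]
      intro a ha b hb
      have hb0 : b ≠ 0 := by
        rintro rfl
        have := hpow 0 hb
        rw [zero_pow (Nat.mul_pos hp.pos hMpos).ne'] at this
        exact zero_ne_one this
      rw [div_pow, hall' a ha, hall' b hb, div_self]
      rw [← hall' b hb]
      exact pow_ne_zero _ hb0
    have := Nat.le_of_dvd hMpos hdvd
    rw [← ho, hM] at this
    have := hp.two_le
    nlinarith
  exact ⟨fun h' => hD0 (hD h'), k, D, hD0, H⟩

open scoped Classical in
theorem card_filter_eq_sum_card_fiber {α β : Type*} (h : Multiset α) (f : α → β) (T : Finset β)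
    (hf : ∀ z ∈ h, f z ∈ T) (P : α → Prop) [DecidablePred P] :
    (h.filter P).card = ∑ t ∈ T, ((h.filter fun z => f z = t).filter P).card := by
  induction h using Multiset.induction with
  | empty => simp
  | cons z h ih =>
    have hz := hf z (Multiset.mem_cons_self z h)
    have ih := ih fun w hw => hf w (Multiset.mem_cons_of_mem hw)
    have key : ∀ t, (((z ::ₘ h).filter fun z => f z = t).filter P).card =
        (if t = f z then (if P z then 1 else 0) else 0) +
        ((h.filter fun z => f z = t).filter P).card := by
      intro t
      by_cases ht : f z = t
      · by_cases hP : P z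
        · simp [ht, hP, add_comm]
        · simp [ht, hP]
      · simp [ht, Ne.symm ht]
    simp only [key, Finset.sum_add_distrib, ← ih, Finset.sum_ite_eq', hz, if_true]
    by_cases hP : P z
    · simp [hP, add_comm]
    · simp [hP]

open scoped Classical in
/-- Every prime dividing the order is at most the weight. -/
theorem IsMinVanishing.prime_le_card {h : Multiset ℂ} (hh : IsSorou h)
    (hm : IsMinVanishing h) (ho : sorouOrder h = relOrder h) {p : ℕ} (hp : p.Prime)
    (hpd : p ∣ sorouOrder h) : p ≤ h.card := by
  obtain ⟨M, hM⟩ := hpd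
  obtain ⟨-, k, D, hD, H⟩ := hm.exists_mul_sum_filter_pow_eq hh ho hp hM
  have hpow : ∀ z ∈ h, z ^ (p * M) = 1 := (hh.sorouOrder_dvd_iff _).1 hM.dvd
  have hcard := card_filter_eq_sum_card_fiber h (fun z => z ^ M)
    (Polynomial.nthRootsFinset p (1 : ℂ))
    (fun z hz => by
      rw [Polynomial.mem_nthRootsFinset hp.pos, ← pow_mul, mul_comm, hpow z hz]) (fun _ => True)
  simp only [Multiset.filter_true] at hcard
  rw [hcard]
  calc p = ∑ t ∈ Polynomial.nthRootsFinset p (1 : ℂ), 1 := by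
        rw [Finset.sum_const, smul_eq_mul, mul_one,
          (Complex.isPrimitiveRoot_exp p hp.ne_zero).card_nthRootsFinset]
    _ ≤ _ := by
        refine Finset.sum_le_sum fun t ht => ?_
        rw [Nat.one_le_iff_ne_zero, Ne, Multiset.card_eq_zero]
        intro h0
        rw [Polynomial.mem_nthRootsFinset hp.pos] at ht
        have := H t ht
        rw [h0, Multiset.sum_zero, mul_zero] at this
        have ht0 : t ≠ 0 := by rintro rfl; simp [hp.ne_zero] at ht
        exact mul_ne_zero (pow_ne_zero _ (inv_ne_zero ht0)) hD this.symm

theorem dvd_thirty_of_prime_le_six {N : ℕ} (hN : 0 < N)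
    (hsq : ∀ p M : ℕ, p.Prime → N = p * M → ¬ p ∣ M)
    (hle : ∀ p : ℕ, p.Prime → p ∣ N → p ≤ 6) : N ∣ 30 := by
  have hsf : Squarefree N := by
    rw [Nat.squarefree_iff_prime_squarefree]
    rintro p hp ⟨c, hc⟩
    exact hsq p (p * c) hp (by rw [hc, mul_assoc]) (dvd_mul_right _ _)
  rw [UniqueFactorizationMonoid.dvd_iff_normalizedFactors_le_normalizedFactors hN.ne'
    (by norm_num)]
  rw [Multiset.le_iff_subset
    ((UniqueFactorizationMonoid.squarefree_iff_nodup_normalizedFactors hN.ne').1 hsf)]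
  intro p hp
  have hpp := (UniqueFactorizationMonoid.prime_of_normalized_factor p hp).nat_prime
  have hpd := UniqueFactorizationMonoid.dvd_of_mem_normalizedFactors hp
  have := hle p hpp hpd
  rw [UniqueFactorizationMonoid.mem_normalizedFactors_iff (by norm_num)]
  refine ⟨hpp.prime, ?_⟩
  interval_cases p <;> first | (exfalso; revert hpp; norm_num; done) | norm_num

theorem IsMinVanishing.neg_notMem {h : Multiset ℂ} (hm : IsMinVanishing h) (hc : 2 < h.card)
    {z : ℂ} (hz : z ∈ h) (hz0 : z ≠ 0) : -z ∉ h := by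
  intro hn
  have hne : z ≠ -z := fun e => hz0 (by linear_combination e / 2)
  refine hm.2 {z, -z} ?_ (by simp) ?_ (by simp)
  · rw [Multiset.le_iff_subset (by simpa using hne)]
    intro w hw
    simp only [Multiset.insert_eq_cons, Multiset.mem_cons, Multiset.mem_singleton] at hw
    rcases hw with rfl | rfl <;> assumption
  · rintro rfl
    simp at hc

open scoped Classical in
/-- A minimal vanishing sorou of weight greater than two in the sixth roots of unity is closed
under multiplication by cube roots of unity. -/
theorem IsMinVanishing.mul_cube_root_mem {h : Multiset ℂ} (hm : IsMinVanishing h)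
    (hc : 2 < h.card) (h6 : ∀ z ∈ h, z ^ 6 = 1) {z ω : ℂ} (hz : z ∈ h) (hω : ω ^ 3 = 1) :
    z * ω ∈ h := by
  obtain ⟨k, D, -, H⟩ := _root_.exists_mul_sum_filter_pow_eq (p := 3) (M := 2) Nat.prime_three
    two_pos h6 hm.1
  have hne : ∀ w ∈ h, w ≠ 0 := by
    rintro w hw rfl
    have := h6 0 hw
    norm_num at this
  have hfib : ∀ w ∈ h, ∃ n : ℕ, 0 < n ∧ (h.filter fun v => v ^ 2 = w ^ 2).sum = n * w := by
    intro w hw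
    have hrep : h.filter (fun v => v ^ 2 = w ^ 2) =
        Multiset.replicate (h.filter fun v => v ^ 2 = w ^ 2).card w := by
      rw [Multiset.eq_replicate]
      refine ⟨rfl, fun v hv => ?_⟩
      rw [Multiset.mem_filter] at hv
      rcases sq_eq_sq_iff_eq_or_eq_neg.1 hv.2 with e | e
      · exact e
      · exact absurd (e ▸ hv.1) (hm.neg_notMem hc hw (hne w hw))
    refine ⟨(h.filter fun v => v ^ 2 = w ^ 2).card, ?_, ?_⟩
    · exact Multiset.card_pos_iff_exists_mem.2 ⟨w, Multiset.mem_filter.2 ⟨hw, rfl⟩⟩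
    · rw [hrep]; simp
  have hz0 := hne z hz
  have hω0 : ω ≠ 0 := by rintro rfl; norm_num at hω
  obtain ⟨n, hn, hnz⟩ := hfib z hz
  have e0 := H (z ^ 2) (by rw [← pow_mul, h6 z hz])
  rw [hnz] at e0
  have e1 := H ((z * ω) ^ 2) (by
    rw [← pow_mul, mul_pow, h6 z hz, show 2 * 3 = 3 * 2 from rfl, pow_mul ω, hω]; norm_num)
  have hn0 : (n : ℂ) ≠ 0 := by exact_mod_cast hn.ne'
  have hD : D ≠ 0 := by
    rintro rfl
    simp [hn0, hz0] at e0
  have hex : ∃ w, w ∈ h.filter fun v => v ^ 2 = (z * ω) ^ 2 := by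
    refine Multiset.exists_mem_of_ne_zero fun h0 => ?_
    rw [h0] at e1
    simp [hz0, hω0, hD] at e1
  obtain ⟨w, hw⟩ := hex
  rw [Multiset.mem_filter] at hw
  rcases sq_eq_sq_iff_eq_or_eq_neg.1 hw.2 with e | e
  · exact e ▸ hw.1
  · exfalso
    obtain ⟨m, hmpos, hmw⟩ := hfib w hw.1
    rw [← hw.2, hmw, hw.2, e] at e1
    have e2 : (m : ℂ) * ω * (ω ^ 2) ^ k = -n := by
      have h1 : ((z * ω) ^ 2)⁻¹ ^ k * (ω ^ 2) ^ k = (z ^ 2)⁻¹ ^ k := by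
        rw [← mul_pow]; congr 1; field_simp
      have h2 : z * ((m : ℂ) * ω * (ω ^ 2) ^ k) = z * -n := by
        push_cast at e0 e1
        linear_combination (-(ω ^ 2) ^ k / 3) * e1 + e0 / 3 - D / 3 * h1
      exact mul_left_cancel₀ hz0 h2
    have e3 : (m : ℂ) ^ 3 = (-n) ^ 3 := by
      have e : ((ω ^ 2) ^ k) ^ 3 = 1 := by
        rw [← pow_mul, ← pow_mul, show 2 * (k * 3) = 3 * (2 * k) by ring, pow_mul, hω, one_pow]
      rw [← e2, mul_pow, mul_pow, hω, e]
      simp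
    have e4 : m ^ 3 + n ^ 3 = 0 := by
      have : (m : ℂ) ^ 3 + (n : ℂ) ^ 3 = 0 := by rw [e3]; ring
      exact_mod_cast this
    have : 0 < m ^ 3 := by positivity
    omega

/-- There is no minimal vanishing sorou of weight greater than three in the sixth roots of
unity. -/
theorem IsMinVanishing.exists_pow_six_ne_one {h : Multiset ℂ} (hm : IsMinVanishing h)
    (hc : 3 < h.card) : ¬ ∀ z ∈ h, z ^ 6 = 1 := by
  intro h6
  obtain ⟨z, hz⟩ := Multiset.card_pos_iff_exists_mem.1 (by omega : 0 < h.card)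
  have hz0 : z ≠ 0 := by
    rintro rfl
    have := h6 0 hz
    norm_num at this
  have hω := Complex.isPrimitiveRoot_exp 3 (by norm_num)
  set ω := Complex.exp (2 * Real.pi * Complex.I / (3 : ℕ))
  have hω1 : ω ≠ 1 := hω.ne_one (by norm_num)
  have hω0 : ω ≠ 0 := hω.ne_zero (by norm_num)
  have hsum : 1 + ω + ω ^ 2 = 0 := by
    have := hω.geom_sum_eq_zero (by norm_num)
    simpa [Finset.sum_range_succ] using this
  have hω2 : ω ^ 2 ≠ 1 := fun e => by
    have := (hω.pow_eq_one_iff_dvd 2).1 e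
    omega
  have m1 := hm.mul_cube_root_mem (by omega) h6 hz hω.pow_eq_one
  have m2 := hm.mul_cube_root_mem (by omega) h6 hz
    (show (ω ^ 2) ^ 3 = 1 by rw [← pow_mul, mul_comm, pow_mul, hω.pow_eq_one, one_pow])
  refine hm.2 {z, z * ω, z * ω ^ 2} ?_ (by simp) ?_ ?_
  · rw [Multiset.le_iff_subset]
    · intro w hw
      simp only [Multiset.insert_eq_cons, Multiset.mem_cons, Multiset.mem_singleton] at hw
      rcases hw with rfl | rfl | rfl <;> assumption
    · have h12 : ω ≠ ω ^ 2 := fun e => hω1 (mul_left_cancel₀ hω0 (by linear_combination -e))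
      have hneg : ω ≠ -1 := fun e => hω2 (by rw [e]; norm_num)
      simp [hz0, h12, hω1, hneg]
  · rintro rfl
    simp at hc
  · simp only [Multiset.insert_eq_cons, Multiset.sum_cons, Multiset.sum_singleton]
    linear_combination z * hsum

open scoped Classical in
theorem oddOrderCount_eq {h : Multiset ℂ} (h30 : ∀ z ∈ h, z ^ 30 = 1) :
    oddOrderCount h = (h.filter fun z => z ^ 15 = 1).card := by
  unfold oddOrderCount
  congr 1
  refine Multiset.filter_congr fun z hz => ?_
  rw [rootOrder_eq_orderOf ⟨30, by norm_num, h30 z hz⟩, ← orderOf_dvd_iff_pow_eq_one]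
  have h1 : orderOf z ∣ 30 := orderOf_dvd_of_pow_eq_one (h30 z hz)
  constructor
  · intro ho
    exact (Nat.Coprime.dvd_mul_left (Nat.coprime_two_right.2 ho)).1 (show orderOf z ∣ 2 * 15 from h1)
  · intro hd
    exact Odd.of_dvd_nat (by decide) hd

theorem oddOrderCount_add_evenOrderCount (h : Multiset ℂ) :
    oddOrderCount h + evenOrderCount h = h.card := by
  classical
  unfold oddOrderCount evenOrderCount
  rw [← Multiset.card_add]
  congr 1
  conv_rhs => rw [← Multiset.filter_add_not (fun z => Odd (rootOrder z)) h]
  congr 1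
  refine Multiset.filter_congr fun z _ => ?_
  rw [Nat.not_odd_iff_even]

theorem pow_fifteen_of_add_eq {x y w : ℂ} (hx : x ^ 30 = 1) (hy : y ^ 30 = 1) (hw : w ^ 30 = 1)
    (h : x + y = w) : x ^ 15 = -w ^ 15 := by
  have hconj : ∀ {v : ℂ}, v ^ 30 = 1 → v ≠ 0 ∧ v⁻¹ = (starRingEnd ℂ) v := by
    intro v hv
    have hn : ‖v‖ = 1 := Complex.norm_eq_one_of_pow_eq_one hv (by norm_num)
    exact ⟨by rintro rfl; norm_num at hv, Complex.inv_eq_conj hn⟩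
  obtain ⟨hx0, hx1⟩ := hconj hx
  obtain ⟨hy0, hy1⟩ := hconj hy
  obtain ⟨hw0, hw1⟩ := hconj hw
  have h1 : x⁻¹ + y⁻¹ = w⁻¹ := by rw [hx1, hy1, hw1, ← h, map_add]
  have h2 : w ^ 2 = x * y := by
    field_simp at h1
    linear_combination h1 + w * -h
  have h3 : x ^ 3 = -w ^ 3 := by
    have : y = w - x := by linear_combination h
    subst this
    linear_combination (x + w) * h2
  rw [show x ^ 15 = (x ^ 3) ^ 5 by ring, h3]
  ring

theorem exists_eq_two_of_sum_eq_card_add_one {ι : Type*} {T : Finset ι} {c : ι → ℕ}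
    (hc : ∀ t ∈ T, 1 ≤ c t) (hs : ∑ t ∈ T, c t = T.card + 1) :
    ∃ t₀ ∈ T, c t₀ = 2 ∧ ∀ t ∈ T, t ≠ t₀ → c t = 1 := by
  classical
  have h1 : ∑ t ∈ T, (c t - 1) = 1 := by
    have : ∑ t ∈ T, (c t - 1) + ∑ t ∈ T, 1 = ∑ t ∈ T, c t := by
      rw [← Finset.sum_add_distrib]
      exact Finset.sum_congr rfl fun t ht => Nat.sub_add_cancel (hc t ht)
    rw [hs, Finset.sum_const, smul_eq_mul, mul_one] at this
    omega
  obtain ⟨t₀, ht₀, hne⟩ := Finset.exists_ne_zero_of_sum_ne_zero (by rw [h1]; exact one_ne_zero)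
  have h2 := Finset.add_sum_erase T (fun t => c t - 1) ht₀
  simp only [h1] at h2
  refine ⟨t₀, ht₀, by omega, fun t ht htt => ?_⟩
  have h3 : ∑ t ∈ T.erase t₀, (c t - 1) = 0 := by omega
  have := Finset.sum_eq_zero_iff.1 h3 t (Finset.mem_erase.2 ⟨htt, ht⟩)
  have := hc t ht
  omega

open scoped Classical in
theorem IsMinVanishing.oddOrderCount_eq_four_or_two {h : Multiset ℂ} (hh : IsSorou h)
    (hm : IsMinVanishing h) (hc : h.card = 6) (ho : sorouOrder h = relOrder h) :
    oddOrderCount h = 4 ∨ oddOrderCount h = 2 := by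
  have hN : sorouOrder h ∣ 30 :=
    dvd_thirty_of_prime_le_six hh.sorouOrder_pos
      (fun p M hp hM => (hm.exists_mul_sum_filter_pow_eq hh ho hp hM).1)
      (fun p hp hpd => hc ▸ hm.prime_le_card hh ho hp hpd)
  have h30 := (hh.sorouOrder_dvd_iff _).1 hN
  have h5 : 5 ∣ sorouOrder h := by
    by_contra h5
    refine hm.exists_pow_six_ne_one (by omega) ((hh.sorouOrder_dvd_iff _).1 ?_)
    exact (Nat.Coprime.dvd_mul_left
      ((Nat.Prime.coprime_iff_not_dvd Nat.prime_five).2 h5).symm).1 (show _ ∣ 5 * 6 from hN)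
  obtain ⟨M, hM⟩ := h5
  obtain ⟨-, k, D, hD, H⟩ := hm.exists_mul_sum_filter_pow_eq hh ho Nat.prime_five hM
  have hpow : ∀ z ∈ h, z ^ (5 * M) = 1 := (hh.sorouOrder_dvd_iff _).1 hM.dvd
  let T := Polynomial.nthRootsFinset 5 (1 : ℂ)
  have hT : ∀ t, t ∈ T ↔ t ^ 5 = 1 := fun t => Polynomial.mem_nthRootsFinset (by norm_num) _
  have hTc : T.card = 5 := (Complex.isPrimitiveRoot_exp 5 (by norm_num)).card_nthRootsFinset
  have hfT : ∀ z ∈ h, z ^ M ∈ T := fun z hz => by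
    rw [hT, ← pow_mul, mul_comm, hpow z hz]
  set F : ℂ → Multiset ℂ := fun t => h.filter fun z => z ^ M = t with hF
  have hFh : ∀ t z, z ∈ F t → z ∈ h := fun t z hz => (Multiset.mem_filter.1 hz).1
  have hFsum : ∀ t ∈ T, (F t).sum = t⁻¹ ^ k * (D / 5) := by
    intro t ht
    have := H t ((hT t).1 ht)
    push_cast at this
    linear_combination this / 5
  have hsum : ∑ t ∈ T, (F t).card = T.card + 1 := by
    have := card_filter_eq_sum_card_fiber h (fun z => z ^ M) T hfT (fun _ => True)
    simp only [Multiset.filter_true] at this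
    rw [← this, hc, hTc]
  have hpos : ∀ t ∈ T, 1 ≤ (F t).card := by
    intro t ht
    rw [Nat.one_le_iff_ne_zero, Ne, Multiset.card_eq_zero]
    intro h0
    have := hFsum t ht
    rw [h0, Multiset.sum_zero] at this
    have ht0 : t ≠ 0 := by
      rintro rfl
      have := (hT 0).1 ht
      norm_num at this
    exact mul_ne_zero (pow_ne_zero _ (inv_ne_zero ht0)) (div_ne_zero hD (by norm_num)) this.symm
  obtain ⟨t₀, ht₀, hc₀, hc₁⟩ := exists_eq_two_of_sum_eq_card_add_one hpos hsum
  set u := D / 5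
  have hu : ∀ t ∈ T, (t⁻¹ ^ k * u) ^ 15 = u ^ 15 := by
    intro t ht
    have : (t⁻¹ ^ k) ^ 15 = 1 := by
      rw [← pow_mul, show k * 15 = 5 * (3 * k) by ring, pow_mul, inv_pow, (hT t).1 ht]
      simp
    rw [mul_pow, this, one_mul]
  have hsingle : ∀ t ∈ T, t ≠ t₀ → ∃ z ∈ h, F t = {z} ∧ z ^ 15 = u ^ 15 := by
    intro t ht htt
    obtain ⟨z, hz⟩ := Multiset.card_eq_one.1 (hc₁ t ht htt)
    refine ⟨z, hFh t z (by simp [hz]), hz, ?_⟩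
    rw [← hu t ht, ← hFsum t ht, hz, Multiset.sum_singleton]
  have hu30 : u ^ 30 = 1 := by
    obtain ⟨t, ht⟩ : (T.erase t₀).Nonempty := by
      rw [← Finset.card_pos, Finset.card_erase_of_mem ht₀, hTc]
      norm_num
    obtain ⟨z, hz, -, e⟩ := hsingle t (Finset.mem_of_mem_erase ht) (Finset.ne_of_mem_erase ht)
    rw [show u ^ 30 = (u ^ 15) ^ 2 by ring, ← e, ← h30 z hz]
    ring
  obtain ⟨x, y, hxy⟩ := Multiset.card_eq_two.1 hc₀
  have hw : x + y = t₀⁻¹ ^ k * u := by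
    rw [← hFsum t₀ ht₀, hxy]
    simp
  have hw30 : (t₀⁻¹ ^ k * u) ^ 30 = 1 := by
    rw [show (t₀⁻¹ ^ k * u) ^ 30 = ((t₀⁻¹ ^ k * u) ^ 15) ^ 2 by ring, hu t₀ ht₀, ← hu30]
    ring
  have hx30 := h30 x (hFh t₀ x (by simp [hxy]))
  have hy30 := h30 y (hFh t₀ y (by simp [hxy]))
  have hx := pow_fifteen_of_add_eq hx30 hy30 hw30 hw
  have hy := pow_fifteen_of_add_eq hy30 hx30 hw30 (by rw [add_comm, hw])
  rw [hu t₀ ht₀] at hx hy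
  rw [oddOrderCount_eq h30, card_filter_eq_sum_card_fiber h (fun z => z ^ M) T hfT,
    ← Finset.add_sum_erase T _ ht₀]
  have hrest : ∀ t ∈ T.erase t₀, ((F t).filter fun z => z ^ 15 = 1).card =
      if u ^ 15 = 1 then 1 else 0 := by
    intro t ht
    obtain ⟨z, -, e, hz⟩ := hsingle t (Finset.mem_of_mem_erase ht) (Finset.ne_of_mem_erase ht)
    rw [e]
    by_cases h1 : u ^ 15 = 1 <;> simp [h1, hz, Multiset.filter_singleton]
  rw [Finset.sum_congr rfl hrest, Finset.sum_const, Finset.card_erase_of_mem ht₀, hTc]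
  change ((F t₀).filter fun z => z ^ 15 = 1).card + _ = 4 ∨
    ((F t₀).filter fun z => z ^ 15 = 1).card + _ = 2
  rw [hxy]
  have hs : u ^ 15 = 1 ∨ u ^ 15 = -1 := by
    exact sq_eq_sq_iff_eq_or_eq_neg.1 (by rw [← pow_mul, hu30, one_pow])
  have hne : (-1 : ℂ) ≠ 1 := by norm_num
  rcases hs with hs | hs
  · left
    simp [hs, hx, hy, hne, Multiset.filter_singleton]
  · right
    simp [hs, hx, hy, hne, Multiset.filter_singleton]

/-- The multiset consisting of `s * ζ` for the primitive fifth roots `ζ` and `-s * ω` for the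
primitive cube roots `ω`. -/
noncomputable def fiveThree (s : ℂ) : Multiset ℂ :=
  (primitiveRoots 5 ℂ).val.map (s * ·) + (primitiveRoots 3 ℂ).val.map (-s * ·)

theorem sum_primitiveRoots_of_prime {p : ℕ} (hp : p.Prime) :
    ∑ z ∈ primitiveRoots p ℂ, z = -1 := by
  have : NeZero p := ⟨hp.ne_zero⟩
  have hζ := Complex.isPrimitiveRoot_exp p hp.ne_zero
  set ζ := Complex.exp (2 * Real.pi * Complex.I / p)
  have h1 : primitiveRoots p ℂ = ((Finset.range p).erase 0).image (ζ ^ ·) := by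
    ext z
    rw [mem_primitiveRoots hp.pos, Finset.mem_image, hζ.isPrimitiveRoot_iff]
    constructor
    · rintro ⟨i, hi, hc, rfl⟩
      refine ⟨i, Finset.mem_erase.2 ⟨?_, Finset.mem_range.2 hi⟩, rfl⟩
      rintro rfl
      exact hp.one_lt.ne' (by simpa using hc)
    · rintro ⟨i, hi, rfl⟩
      rw [Finset.mem_erase, Finset.mem_range] at hi
      exact ⟨i, hi.2, (Nat.coprime_of_lt_prime hi.1 hi.2 hp).symm, rfl⟩
  rw [h1, Finset.sum_image]
  · have h2 := Finset.add_sum_erase (Finset.range p) (ζ ^ ·) (Finset.mem_range.2 hp.pos)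
    rw [hζ.geom_sum_eq_zero hp.one_lt] at h2
    linear_combination h2
  · intro i hi j hj e
    exact hζ.pow_inj (Finset.mem_range.1 (Finset.mem_of_mem_erase hi))
      (Finset.mem_range.1 (Finset.mem_of_mem_erase hj)) e

theorem mem_fiveThree {s z : ℂ} : z ∈ fiveThree s ↔
    (∃ a, IsPrimitiveRoot a 5 ∧ z = s * a) ∨ ∃ b, IsPrimitiveRoot b 3 ∧ z = -s * b := by
  simp only [fiveThree, Multiset.mem_add, Multiset.mem_map, Finset.mem_val]
  refine or_congr (exists_congr fun a => ?_) (exists_congr fun b => ?_)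
  · rw [mem_primitiveRoots (by norm_num), eq_comm]
  · rw [mem_primitiveRoots (by norm_num), eq_comm]

theorem card_fiveThree (s : ℂ) : (fiveThree s).card = 6 := by
  rw [fiveThree, Multiset.card_add, Multiset.card_map, Multiset.card_map, Finset.card_val,
    Finset.card_val, (Complex.isPrimitiveRoot_exp 5 (by norm_num)).card_primitiveRoots,
    (Complex.isPrimitiveRoot_exp 3 (by norm_num)).card_primitiveRoots,
    Nat.totient_prime Nat.prime_five, Nat.totient_prime Nat.prime_three]

theorem sum_fiveThree (s : ℂ) : (fiveThree s).sum = 0 := by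
  have h5 := sum_primitiveRoots_of_prime Nat.prime_five
  have h3 := sum_primitiveRoots_of_prime Nat.prime_three
  simp only [Finset.sum, Multiset.map_id'] at h5 h3
  rw [fiveThree, Multiset.sum_add, Multiset.sum_map_mul_left, Multiset.sum_map_mul_left,
    Multiset.map_id', Multiset.map_id', h5, h3]
  ring

theorem IsPrimitiveRoot.sq_add_self_add_one {b : ℂ} (hb : IsPrimitiveRoot b 3) :
    b ^ 2 + b + 1 = 0 := by
  have := hb.geom_sum_eq_zero (by norm_num)
  simp only [Finset.sum_range_succ, Finset.sum_range_zero] at this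
  linear_combination this

/-- Elements of `fiveThree s` with equal sixth powers. -/
theorem add_eq_of_mem_fiveThree {s x y : ℂ} (hs : s ^ 2 = 1) (hx : x ∈ fiveThree s)
    (hy : y ∈ fiveThree s) (hxy : x ≠ y) (h6 : x ^ 6 = y ^ 6) : x + y = s := by
  have hs6 : s ^ 6 = 1 := by rw [show s ^ 6 = (s ^ 2) ^ 3 by ring, hs, one_pow]
  have ha : ∀ {a : ℂ}, IsPrimitiveRoot a 5 → (s * a) ^ 6 = a := fun {a} h => by
    rw [mul_pow, hs6, one_mul, pow_succ, h.pow_eq_one, one_mul]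
  have hb : ∀ {b : ℂ}, IsPrimitiveRoot b 3 → (-s * b) ^ 6 = 1 := fun {b} h => by
    rw [show (-s * b) ^ 6 = s ^ 6 * (b ^ 3) ^ 2 by ring, hs6, h.pow_eq_one]
    norm_num
  rcases mem_fiveThree.1 hx with ⟨a, h1, rfl⟩ | ⟨a, h1, rfl⟩ <;>
    rcases mem_fiveThree.1 hy with ⟨b, h2, rfl⟩ | ⟨b, h2, rfl⟩
  · rw [ha h1, ha h2] at h6
    exact absurd (by rw [h6]) hxy
  · rw [ha h1, hb h2] at h6
    exact absurd h6 (h1.ne_one (by norm_num))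
  · rw [hb h1, ha h2] at h6
    exact absurd h6.symm (h2.ne_one (by norm_num))
  · have hab : a - b ≠ 0 := fun e => hxy (by rw [sub_eq_zero.1 e])
    have := mul_left_cancel₀ hab (show (a - b) * (a + b + 1) = (a - b) * 0 by
      linear_combination h1.sq_add_self_add_one - h2.sq_add_self_add_one)
    linear_combination -s * this

theorem nodup_fiveThree {s : ℂ} (hs : s ^ 2 = 1) : (fiveThree s).Nodup := by
  have hs0 : s ≠ 0 := by rintro rfl; norm_num at hs
  rw [fiveThree, Multiset.nodup_add]
  refine ⟨(Finset.nodup _).map (mul_right_injective₀ hs0),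
    (Finset.nodup _).map (mul_right_injective₀ (neg_ne_zero.2 hs0)), ?_⟩
  rw [Multiset.disjoint_left]
  intro z h1 h2
  simp only [Multiset.mem_map, Finset.mem_val] at h1 h2
  obtain ⟨a, ha, rfl⟩ := h1
  obtain ⟨b, hb, e⟩ := h2
  rw [mem_primitiveRoots (by norm_num)] at ha hb
  have hab : a = -b := mul_left_cancel₀ hs0 (by linear_combination -e)
  have h6 : a ^ 6 = 1 := by
    rw [hab, show (-b) ^ 6 = (b ^ 3) ^ 2 by ring, hb.pow_eq_one, one_pow]
  have := (ha.pow_eq_one_iff_dvd 6).1 h6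
  omega

theorem pow_thirty_of_mem_fiveThree {s z : ℂ} (hs : s ^ 2 = 1) (hz : z ∈ fiveThree s) :
    z ^ 30 = 1 := by
  have hs30 : s ^ 30 = 1 := by rw [show s ^ 30 = (s ^ 2) ^ 15 by ring, hs, one_pow]
  rcases mem_fiveThree.1 hz with ⟨a, h, rfl⟩ | ⟨a, h, rfl⟩
  · rw [show (s * a) ^ 30 = s ^ 30 * (a ^ 5) ^ 6 by ring, hs30, h.pow_eq_one]; norm_num
  · rw [show (-s * a) ^ 30 = s ^ 30 * (a ^ 3) ^ 10 by ring, hs30, h.pow_eq_one]; norm_num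

theorem isSorou_fiveThree {s : ℂ} (hs : s ^ 2 = 1) : IsSorou (fiveThree s) := by
  refine ⟨fun h0 => ?_, fun z hz => ⟨30, by norm_num, pow_thirty_of_mem_fiveThree hs hz⟩⟩
  have := card_fiveThree s
  rw [h0] at this
  simp at this

/-- Vanishing sums of at most three roots of unity have all sixth powers equal, which is
impossible inside `fiveThree s`. -/
theorem sum_ne_zero_of_le_fiveThree {s : ℂ} (hs : s ^ 2 = 1) {g : Multiset ℂ}
    (hg : g ≤ fiveThree s) (hg0 : g ≠ 0) (hc : g.card ≤ 3) : g.sum ≠ 0 := by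
  intro hsum
  have hs0 : s ≠ 0 := by rintro rfl; norm_num at hs
  have hmem : ∀ z ∈ g, z ∈ fiveThree s := fun z hz => Multiset.mem_of_le hg hz
  have hnd := Multiset.nodup_of_le hg (nodup_fiveThree hs)
  have hpos : 0 < g.card := Multiset.card_pos.2 hg0
  have hconj : ∀ z ∈ g, z ≠ 0 ∧ z⁻¹ = (starRingEnd ℂ) z := by
    intro z hz
    have h30 := pow_thirty_of_mem_fiveThree hs (hmem z hz)
    exact ⟨by rintro rfl; norm_num at h30,
      Complex.inv_eq_conj (Complex.norm_eq_one_of_pow_eq_one h30 (by norm_num))⟩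
  obtain h1 | h2 | h3 : g.card = 1 ∨ g.card = 2 ∨ g.card = 3 := by omega
  · obtain ⟨x, rfl⟩ := Multiset.card_eq_one.1 h1
    exact (hconj x (by simp)).1 (by simpa using hsum)
  · obtain ⟨x, y, rfl⟩ := Multiset.card_eq_two.1 h2
    have hxy : x + y = 0 := by simpa using hsum
    have hne : x ≠ y := by simpa using hnd
    have := add_eq_of_mem_fiveThree hs (hmem x (by simp)) (hmem y (by simp)) hne
      (by rw [eq_neg_of_add_eq_zero_left hxy]; ring)
    exact hs0 (by rw [← this, hxy])
  · obtain ⟨x, y, z, rfl⟩ := Multiset.card_eq_three.1 h3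
    have hxyz : x + y + z = 0 := by simpa [add_assoc] using hsum
    obtain ⟨hx0, hx⟩ := hconj x (by simp)
    obtain ⟨hy0, hy⟩ := hconj y (by simp)
    obtain ⟨hz0, hz⟩ := hconj z (by simp)
    have hinv : x⁻¹ + y⁻¹ + z⁻¹ = 0 := by rw [hx, hy, hz, ← map_add, ← map_add, hxyz, map_zero]
    have he2 : x * y + y * z + z * x = 0 := by
      field_simp at hinv
      linear_combination hinv
    have hxy3 : x ^ 3 = y ^ 3 := by
      linear_combination (x - y) * (x + y) * hxyz - (x - y) * he2
    have hxz3 : x ^ 3 = z ^ 3 := by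
      linear_combination (x - z) * (x + z) * hxyz - (x - z) * he2
    simp only [Multiset.insert_eq_cons, Multiset.nodup_cons, Multiset.mem_cons,
      Multiset.mem_singleton, not_or] at hnd
    have e1 := add_eq_of_mem_fiveThree hs (hmem x (by simp)) (hmem y (by simp)) hnd.1.1
      (by linear_combination (x ^ 3 + y ^ 3) * hxy3)
    have e2 := add_eq_of_mem_fiveThree hs (hmem x (by simp)) (hmem z (by simp)) hnd.1.2
      (by linear_combination (x ^ 3 + z ^ 3) * hxz3)
    exact hnd.2.1 (by linear_combination e1 - e2)

theorem isMinVanishing_fiveThree {s : ℂ} (hs : s ^ 2 = 1) : IsMinVanishing (fiveThree s) := by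
  refine ⟨sum_fiveThree s, fun g hg hg0 hgne hsum => ?_⟩
  by_cases hc : g.card ≤ 3
  · exact sum_ne_zero_of_le_fiveThree hs hg hg0 hc hsum
  · obtain ⟨g', hg'⟩ := Multiset.le_iff_exists_add.1 hg
    have hcard := card_fiveThree s
    rw [hg', Multiset.card_add] at hcard
    refine sum_ne_zero_of_le_fiveThree hs (g := g') ?_ ?_ (by omega) ?_
    · rw [hg']; exact Multiset.le_add_left _ _
    · rintro rfl
      exact hgne (by rw [hg', add_zero])
    · have := sum_fiveThree s
      rwa [hg', Multiset.sum_add, hsum, zero_add] at this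

theorem sorouOrder_fiveThree_eq_relOrder {s : ℂ} (hs : s ^ 2 = 1) :
    sorouOrder (fiveThree s) = relOrder (fiveThree s) := by
  have hh := isSorou_fiveThree hs
  have hs0 : s ≠ 0 := by rintro rfl; norm_num at hs
  have hrel : relOrder (fiveThree s) ∣ sorouOrder (fiveThree s) := by
    rw [hh.relOrder_dvd_iff]
    have := (hh.sorouOrder_dvd_iff _).1 dvd_rfl
    intro a ha b hb
    rw [div_pow, this a ha, this b hb, div_one]
  have h30 : sorouOrder (fiveThree s) ∣ 30 :=
    (hh.sorouOrder_dvd_iff _).2 fun z hz => pow_thirty_of_mem_fiveThree hs hz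
  refine Nat.dvd_antisymm (h30.trans ?_) hrel
  have hζ := Complex.isPrimitiveRoot_exp 5 (by norm_num)
  have hω := Complex.isPrimitiveRoot_exp 3 (by norm_num)
  set ζ := Complex.exp (2 * Real.pi * Complex.I / (5 : ℕ))
  set ω := Complex.exp (2 * Real.pi * Complex.I / (3 : ℕ))
  have hζ0 : ζ ≠ 0 := hζ.ne_zero (by norm_num)
  have hpow := (hh.relOrder_dvd_iff _).1 dvd_rfl
    (-s * ω) (mem_fiveThree.2 (Or.inr ⟨ω, hω, rfl⟩)) (s * ζ) (mem_fiveThree.2 (Or.inl ⟨ζ, hζ, rfl⟩))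
  set R := relOrder (fiveThree s)
  have hq : (-s * ω) / (s * ζ) = -ω / ζ := by field_simp
  have hq : ((-1) * ω) ^ R = ζ ^ R := by
    rw [hq, div_pow, div_eq_one_iff_eq (pow_ne_zero _ hζ0)] at hpow
    simpa using hpow
  have h2 : Even R := by
    by_contra hodd
    rw [Nat.not_even_iff_odd] at hodd
    have h15 := congrArg (· ^ 15) hq
    simp only [mul_pow, ← pow_mul] at h15
    rw [show R * 15 = 3 * (5 * R) by ring, pow_mul ω, hω.pow_eq_one,
      show 3 * (5 * R) = 5 * (3 * R) by ring, pow_mul ζ, hζ.pow_eq_one,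
      Odd.neg_one_pow (by
        rw [show 5 * (3 * R) = 15 * R by ring]; exact Odd.mul (by decide) hodd)] at h15
    norm_num at h15
  rw [mul_pow, h2.neg_one_pow, one_mul] at hq
  have h3 : 3 ∣ R := by
    have : ω ^ (5 * R) = 1 := by
      rw [mul_comm, pow_mul, hq, ← pow_mul, mul_comm, pow_mul, hζ.pow_eq_one, one_pow]
    have := (hω.pow_eq_one_iff_dvd _).1 this
    omega
  have h5 : 5 ∣ R := by
    have : ζ ^ (3 * R) = 1 := by
      rw [mul_comm, pow_mul, ← hq, ← pow_mul, mul_comm, pow_mul, hω.pow_eq_one, one_pow]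
    have := (hζ.pow_eq_one_iff_dvd _).1 this
    omega
  have := h2.two_dvd
  omega

open scoped Classical in
theorem oddOrderCount_fiveThree {s : ℂ} (hs : s ^ 2 = 1) :
    oddOrderCount (fiveThree s) = (if s = 1 then 4 else 0) + if s = -1 then 2 else 0 := by
  have hs15 : s ^ 15 = s := by
    rw [show s ^ 15 = (s ^ 2) ^ 7 * s by ring, hs, one_pow, one_mul]
  rw [oddOrderCount_eq fun z hz => pow_thirty_of_mem_fiveThree hs hz, fiveThree,
    Multiset.filter_add, Multiset.card_add, Multiset.filter_map, Multiset.filter_map,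
    Multiset.card_map, Multiset.card_map]
  have ha : ∀ a ∈ (primitiveRoots 5 ℂ).val, (s * a) ^ 15 = s := by
    intro a ha
    rw [Finset.mem_val, mem_primitiveRoots (by norm_num)] at ha
    rw [show (s * a) ^ 15 = s ^ 15 * (a ^ 5) ^ 3 by ring, hs15, ha.pow_eq_one]
    ring
  have hb : ∀ b ∈ (primitiveRoots 3 ℂ).val, (-s * b) ^ 15 = -s := by
    intro b hb
    rw [Finset.mem_val, mem_primitiveRoots (by norm_num)] at hb
    rw [show (-s * b) ^ 15 = -s ^ 15 * (b ^ 3) ^ 5 by ring, hs15, hb.pow_eq_one]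
    ring
  have c5 : (primitiveRoots 5 ℂ).val.card = 4 := by
    rw [Finset.card_val, (Complex.isPrimitiveRoot_exp 5 (by norm_num)).card_primitiveRoots,
      Nat.totient_prime Nat.prime_five]
  have c3 : (primitiveRoots 3 ℂ).val.card = 2 := by
    rw [Finset.card_val, (Complex.isPrimitiveRoot_exp 3 (by norm_num)).card_primitiveRoots,
      Nat.totient_prime Nat.prime_three]
  congr 1
  · rw [Multiset.filter_congr (q := fun _ => s = 1) fun a h => by
      simp only [Function.comp_apply, ha a h]]
    by_cases h1 : s = 1 <;> simp [h1, c5]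
  · rw [Multiset.filter_congr (q := fun _ => s = -1) fun b h => by
      simp only [Function.comp_apply, hb b h, neg_eq_iff_eq_neg]]
    by_cases h1 : s = -1 <;> simp [h1, c3]

theorem stmt_14 :
    (∀ h : Multiset ℂ, IsSorou h → IsMinVanishing h → Multiset.card h = 6 →
      sorouOrder h = relOrder h →
      (oddOrderCount h = 4 ∧ evenOrderCount h = 2) ∨
      (oddOrderCount h = 2 ∧ evenOrderCount h = 4)) ∧
    (∃ h : Multiset ℂ, IsSorou h ∧ IsMinVanishing h ∧ Multiset.card h = 6 ∧
      sorouOrder h = relOrder h ∧ oddOrderCount h = 4 ∧ evenOrderCount h = 2) ∧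
    (∃ h : Multiset ℂ, IsSorou h ∧ IsMinVanishing h ∧ Multiset.card h = 6 ∧
      sorouOrder h = relOrder h ∧ oddOrderCount h = 2 ∧ evenOrderCount h = 4) := by
  refine ⟨fun h hh hm hc ho => ?_, ?_, ?_⟩
  · have hsum := oddOrderCount_add_evenOrderCount h
    rcases hm.oddOrderCount_eq_four_or_two hh hc ho with h4 | h2 <;> omega
  · have hs : (1 : ℂ) ^ 2 = 1 := one_pow 2
    have hodd : oddOrderCount (fiveThree 1) = 4 := by
      rw [oddOrderCount_fiveThree hs]
      norm_num
    have hsum := oddOrderCount_add_evenOrderCount (fiveThree 1)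
    have hc := card_fiveThree 1
    exact ⟨fiveThree 1, isSorou_fiveThree hs, isMinVanishing_fiveThree hs, hc,
      sorouOrder_fiveThree_eq_relOrder hs, hodd, by omega⟩
  · have hs : (-1 : ℂ) ^ 2 = 1 := by norm_num
    have hodd : oddOrderCount (fiveThree (-1)) = 2 := by
      rw [oddOrderCount_fiveThree hs]
      norm_num
    have hsum := oddOrderCount_add_evenOrderCount (fiveThree (-1))
    have hc := card_fiveThree (-1)
    exact ⟨fiveThree (-1), isSorou_fiveThree hs, isMinVanishing_fiveThree hs, hc,
      sorouOrder_fiveThree_eq_relOrder hs, hodd, by omega⟩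
end

section
/- The multiset consisting of the elements ν_7^j and ν_7^j ν_5 for j = 0, 1, …, 5, together with the elements −ν_7^6 ν_5^2, −ν_7^6 ν_5^3, and −ν_7^6 ν_5^4, is a minimal vanishing sorou of weight 15 and height 1. -/
open Complex

noncomputable def stmt16Sorou : Multiset ℂ :=
  ((Multiset.range 6).bind fun j => ({nu 7 ^ j, nu 7 ^ j * nu 5} : Multiset ℂ)) +
  ({-(nu 7 ^ 6 * nu 5 ^ 2), -(nu 7 ^ 6 * nu 5 ^ 3), -(nu 7 ^ 6 * nu 5 ^ 4)} : Multiset ℂ)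

open Polynomial in
/-- If a `K`-linear relation between `1, μ, …, μ ^ (p - 1)` holds for every primitive `p`-th root of
unity `μ`, then all its coefficients agree. -/
lemma eq_of_forall_primitiveRoot_sum_eq_zero {K : Type*} [Field K] {p : ℕ} (hp : p.Prime)
    {a : K} (ha : IsPrimitiveRoot a p) (d : ℕ → K)
    (h : ∀ μ : K, IsPrimitiveRoot μ p → ∑ j ∈ Finset.range p, d j * μ ^ j = 0)
    {i j : ℕ} (hi : i < p) (hj : j < p) : d i = d j := by
  obtain ⟨n, rfl⟩ : ∃ n, p = n + 1 := ⟨p - 1, (Nat.succ_pred hp.ne_zero).symm⟩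
  set g : K[X] := ∑ j ∈ Finset.range n, C (d j - d n) * X ^ j with hg
  have hn : 0 < n := by have := hp.two_le; omega
  have hdeg : g.natDegree < (primitiveRoots (n + 1) K).card := by
    rw [ha.card_primitiveRoots, Nat.totient_prime hp, Nat.add_sub_cancel]
    refine lt_of_le_of_lt (natDegree_sum_le_of_forall_le (n := n - 1) _ _ fun k hk => ?_)
      (Nat.sub_lt hn one_pos)
    refine (natDegree_C_mul_X_pow_le _ _).trans ?_
    have := Finset.mem_range.1 hk
    omega
  have hzero : g = 0 := by
    refine eq_zero_of_natDegree_lt_card_of_eval_eq_zero' g _ (fun μ hμ => ?_) hdeg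
    have hμ' := isPrimitiveRoot_of_mem_primitiveRoots hμ
    have h1 := h μ hμ'
    have h2 := hμ'.geom_sum_eq_zero hp.one_lt
    rw [Finset.sum_range_succ] at h1 h2
    simp only [hg, eval_finsetSum, eval_mul, eval_C, eval_pow, eval_X, sub_mul,
      Finset.sum_sub_distrib, ← Finset.mul_sum]
    linear_combination h1 - d n * h2
  have key : ∀ k < n + 1, d k = d n := by
    intro k hk
    rcases Nat.lt_succ_iff_lt_or_eq.1 hk with hk | rfl
    · have := congrArg (fun q => coeff q k) hzero
      simpa only [hg, finsetSum_coeff, coeff_C_mul, coeff_X_pow, mul_ite, mul_one, mul_zero,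
        Finset.sum_ite_eq, Finset.mem_range, hk, if_true, coeff_zero, sub_eq_zero] using this
    · rfl
  rw [key i hi, key j hj]

lemma IsPrimitiveRoot.mul_of_coprime {K : Type*} [Field K] {m n : ℕ} {a b : K}
    (ha : IsPrimitiveRoot a m) (hb : IsPrimitiveRoot b n) (hmn : m.Coprime n) :
    IsPrimitiveRoot (a * b) (m * n) := by
  rw [IsPrimitiveRoot.iff_orderOf] at *
  subst ha hb
  exact (Commute.all a b).orderOf_mul_eq_mul_orderOf_of_coprime hmn

lemma IsPrimitiveRoot.mul_pow_eq_of_modEq {K : Type*} [Field K] {m n : ℕ} {a b : K}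
    (ha : IsPrimitiveRoot a m) (hb : IsPrimitiveRoot b n) {u x y : ℕ}
    (hu : u ≡ x [MOD m]) (hv : u ≡ y [MOD n]) : (a * b) ^ u = a ^ x * b ^ y := by
  rw [mul_pow, pow_eq_pow_of_modEq hu ha.pow_eq_one, pow_eq_pow_of_modEq hv hb.pow_eq_one]

open Polynomial in
/-- Rational relations between products of two roots of unity of coprime orders `m` and `n` are
stable under replacing the two roots by arbitrary primitive roots of the same orders. -/
lemma sum_primitiveRoots_eq_zero_of_coprime {K : Type*} [Field K] [CharZero K] {m n : ℕ}
    (hm : 0 < m) (hn : 0 < n) (hmn : m.Coprime n) {a b a' b' : K}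
    (ha : IsPrimitiveRoot a m) (hb : IsPrimitiveRoot b n)
    (ha' : IsPrimitiveRoot a' m) (hb' : IsPrimitiveRoot b' n) (s : Finset (ℕ × ℕ))
    (c : ℕ × ℕ → ℚ) (h : ∑ x ∈ s, (c x : K) * (a ^ x.1 * b ^ x.2) = 0) :
    ∑ x ∈ s, (c x : K) * (a' ^ x.1 * b' ^ x.2) = 0 := by
  let e (x : ℕ × ℕ) : ℕ := Nat.chineseRemainder hmn x.1 x.2
  have he (x : ℕ × ℕ) : e x ≡ x.1 [MOD m] ∧ e x ≡ x.2 [MOD n] :=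
    (Nat.chineseRemainder hmn x.1 x.2).2
  let P : ℚ[X] := ∑ x ∈ s, C (c x) * X ^ e x
  have hP {α β : K} (hα : IsPrimitiveRoot α m) (hβ : IsPrimitiveRoot β n) :
      aeval (α * β) P = ∑ x ∈ s, (c x : K) * (α ^ x.1 * β ^ x.2) := by
    simp only [P, map_sum, map_mul, aeval_C, map_pow, aeval_X, eq_ratCast]
    exact Finset.sum_congr rfl fun x _ => by
      rw [hα.mul_pow_eq_of_modEq hβ (he x).1 (he x).2]
  rw [← hP ha hb] at h
  rw [← hP ha' hb']
  have hmn0 : 0 < m * n := Nat.mul_pos hm hn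
  have hdvd := minpoly.dvd ℚ _ h
  rw [← cyclotomic_eq_minpoly_rat (ha.mul_of_coprime hb hmn) hmn0,
    cyclotomic_eq_minpoly_rat (ha'.mul_of_coprime hb' hmn) hmn0] at hdvd
  exact aeval_eq_zero_of_dvd_aeval_eq_zero hdvd (minpoly.aeval _ _)

/-- In a rational relation between the products `a ^ j * b ^ k` of roots of unity of distinct prime
orders, the coefficients split as a function of `j` plus a function of `k`. -/
lemma add_eq_add_of_sum_primitiveRoots_eq_zero {K : Type*} [Field K] [CharZero K] {p q : ℕ}
    (hp : p.Prime) (hq : q.Prime) (hpq : p ≠ q) {a b : K}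
    (ha : IsPrimitiveRoot a p) (hb : IsPrimitiveRoot b q) (c : ℕ × ℕ → ℚ)
    (h : ∑ x ∈ Finset.range p ×ˢ Finset.range q, (c x : K) * (a ^ x.1 * b ^ x.2) = 0)
    {i j k l : ℕ} (hi : i < p) (hj : j < p) (hk : k < q) (hl : l < q) :
    c (i, k) + c (j, l) = c (i, l) + c (j, k) := by
  have hcol (β : K) (hβ : IsPrimitiveRoot β q) :
      ∑ k ∈ Finset.range q, ((c (i, k) : K) - c (j, k)) * β ^ k = 0 := by
    have := eq_of_forall_primitiveRoot_sum_eq_zero hp ha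
      (fun i => ∑ k ∈ Finset.range q, (c (i, k) : K) * β ^ k) (fun α hα => ?_) hi hj
    · simpa only [sub_mul, Finset.sum_sub_distrib, sub_eq_zero] using this
    · have := sum_primitiveRoots_eq_zero_of_coprime hp.pos hq.pos
        ((Nat.coprime_primes hp hq).2 hpq) ha hb hα hβ _ c h
      rw [Finset.sum_product] at this
      rw [← this]
      refine Finset.sum_congr rfl fun x _ => ?_
      rw [Finset.sum_mul]
      exact Finset.sum_congr rfl fun y _ => by ring
  have := eq_of_forall_primitiveRoot_sum_eq_zero hq hb _ hcol hk hl
  have h' : (c (i, k) : K) - c (j, k) = c (i, l) - c (j, l) := this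
  have h'' : c (i, k) - c (j, k) = c (i, l) - c (j, l) := by exact_mod_cast h'
  linarith

lemma isPrimitiveRoot_nu {n : ℕ} (hn : n ≠ 0) : IsPrimitiveRoot (nu n) n :=
  Complex.isPrimitiveRoot_exp n hn

/-- The exponents `(j, k)` of the elements `± ν₇ ^ j * ν₅ ^ k` of `stmt16Sorou`. -/
def sorouIndex : Finset (ℕ × ℕ) :=
  ⟨((Multiset.range 6).bind fun j => {(j, 0), (j, 1)}) + {(6, 2), (6, 3), (6, 4)}, by decide⟩

def sorouSign (x : ℕ × ℕ) : ℚ := if x.1 < 6 then 1 else -1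

noncomputable def sorouTerm (x : ℕ × ℕ) : ℂ := sorouSign x * (nu 7 ^ x.1 * nu 5 ^ x.2)

lemma sorouSign_ne_zero (x : ℕ × ℕ) : sorouSign x ≠ 0 := by
  unfold sorouSign; split_ifs <;> norm_num

lemma mem_sorouIndex {x : ℕ × ℕ} :
    x ∈ sorouIndex ↔ x.1 < 6 ∧ x.2 < 2 ∨ x.1 = 6 ∧ 2 ≤ x.2 ∧ x.2 < 5 := by
  obtain ⟨j, k⟩ := x
  simp only [sorouIndex, Finset.mem_mk, Multiset.mem_add, Multiset.mem_bind, Multiset.mem_range,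
    Multiset.insert_eq_cons, Multiset.mem_cons, Multiset.mem_singleton, Prod.mk.injEq]
  constructor
  · rintro (⟨a, h⟩ | h) <;> omega
  · rintro (h | h)
    · exact Or.inl ⟨j, by omega⟩
    · omega

lemma sorouIndex_subset : sorouIndex ⊆ Finset.range 7 ×ˢ Finset.range 5 := by
  intro x hx
  rw [mem_sorouIndex] at hx
  simp only [Finset.mem_product, Finset.mem_range]
  omega

lemma stmt16Sorou_eq_map : stmt16Sorou = sorouIndex.val.map sorouTerm := by
  simp only [stmt16Sorou, sorouIndex, Multiset.map_add, Multiset.map_bind]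
  congr 1
  · refine Multiset.bind_congr fun j hj => ?_
    simp [sorouTerm, sorouSign, Multiset.mem_range.1 hj]
  · simp [sorouTerm, sorouSign]

/-- The coefficients of a rational relation between the `nu 7 ^ j * nu 5 ^ k`. -/
lemma add_eq_add_of_sum_nu_eq_zero (c : ℕ × ℕ → ℚ)
    (h : ∑ x ∈ Finset.range 7 ×ˢ Finset.range 5, (c x : ℂ) * (nu 7 ^ x.1 * nu 5 ^ x.2) = 0)
    {i j k l : ℕ} (hi : i < 7) (hj : j < 7) (hk : k < 5) (hl : l < 5) :
    c (i, k) + c (j, l) = c (i, l) + c (j, k) :=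
  add_eq_add_of_sum_primitiveRoots_eq_zero (by norm_num) (by norm_num) (by norm_num)
    (isPrimitiveRoot_nu (by norm_num)) (isPrimitiveRoot_nu (by norm_num)) c h hi hj hk hl

lemma sorouTerm_injOn : Set.InjOn sorouTerm sorouIndex := by
  intro x hx y hy hxy
  by_contra hne
  have hx' := Finset.mem_product.1 (sorouIndex_subset hx)
  let c (z : ℕ × ℕ) : ℚ := (if z = x then sorouSign x else 0) - if z = y then sorouSign y else 0
  have hc : ∑ z ∈ Finset.range 7 ×ˢ Finset.range 5, (c z : ℂ) * (nu 7 ^ z.1 * nu 5 ^ z.2) = 0 := by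
    have hx := sorouIndex_subset hx
    have hy := sorouIndex_subset hy
    simp only [c, Rat.cast_sub, sub_mul, Finset.sum_sub_distrib, apply_ite (Rat.cast (K := ℂ)),
      Rat.cast_zero, ite_mul, zero_mul, Finset.sum_ite_eq', hx, hy, if_true]
    exact sub_eq_zero.2 hxy
  obtain ⟨j, hj, hjx, hjy⟩ : ∃ j < 7, j ≠ x.1 ∧ j ≠ y.1 := by
    by_contra! H
    have h0 := H 0; have h1 := H 1; have h2 := H 2
    omega
  obtain ⟨l, hl, hlx, hly⟩ : ∃ l < 5, l ≠ x.2 ∧ l ≠ y.2 := by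
    by_contra! H
    have h0 := H 0; have h1 := H 1; have h2 := H 2
    omega
  have := add_eq_add_of_sum_nu_eq_zero c hc (Finset.mem_range.1 hx'.1) hj
    (Finset.mem_range.1 hx'.2) hl
  simp only [c, Prod.ext_iff, hjx, hjy, hlx, hly, and_false, false_and, if_false, sub_zero,
    add_zero] at this
  grind [sorouSign_ne_zero]

lemma nodup_stmt16Sorou : stmt16Sorou.Nodup := by
  rw [stmt16Sorou_eq_map]
  exact Multiset.Nodup.map_on (fun x hx y hy h => sorouTerm_injOn hx hy h) sorouIndex.nodup

lemma sum_stmt16Sorou : stmt16Sorou.sum = 0 := by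
  have h7 := (isPrimitiveRoot_nu (n := 7) (by norm_num)).geom_sum_eq_zero (by norm_num)
  have h5 := (isPrimitiveRoot_nu (n := 5) (by norm_num)).geom_sum_eq_zero (by norm_num)
  simp only [Finset.sum_range_succ, Finset.sum_range_zero] at h7 h5
  simp only [stmt16Sorou, Multiset.sum_add, Multiset.sum_bind, Multiset.insert_eq_cons,
    Multiset.sum_cons, Multiset.sum_singleton]
  change ∑ j ∈ Finset.range 6, (nu 7 ^ j + nu 7 ^ j * nu 5) + _ = 0
  simp only [Finset.sum_range_succ, Finset.sum_range_zero]
  linear_combination (1 + nu 5) * h7 - nu 7 ^ 6 * h5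

/-- A vanishing subfamily of the terms of `stmt16Sorou` is empty or the whole family. -/
lemma eq_empty_or_eq_sorouIndex {U : Finset (ℕ × ℕ)} (hU : U ⊆ sorouIndex)
    (h : ∑ x ∈ U, sorouTerm x = 0) : U = ∅ ∨ U = sorouIndex := by
  let c (z : ℕ × ℕ) : ℚ := if z ∈ U then sorouSign z else 0
  have hc : ∑ z ∈ Finset.range 7 ×ˢ Finset.range 5, (c z : ℂ) * (nu 7 ^ z.1 * nu 5 ^ z.2) = 0 := by
    simp only [c, apply_ite (Rat.cast (K := ℂ)), Rat.cast_zero, ite_mul, zero_mul,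
      Finset.sum_ite_mem]
    rwa [Finset.inter_eq_right.2 (hU.trans sorouIndex_subset)]
  have key {j k l : ℕ} (hj : j < 6) (hk : k < 2) (hl : 2 ≤ l) (hl' : l < 5) :
      (j, k) ∈ U ↔ (6, l) ∈ U := by
    have hrel := add_eq_add_of_sum_nu_eq_zero c hc (i := j) (j := 6) (k := k) (l := l)
      (by omega) (by omega) (by omega) hl'
    have h1 : (j, l) ∉ U := fun h => by have := mem_sorouIndex.1 (hU h); grind
    have h2 : (6, k) ∉ U := fun h => by have := mem_sorouIndex.1 (hU h); grind
    simp only [c, h1, h2, if_false, add_zero, sorouSign, hj, if_true, lt_irrefl] at hrel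
    by_cases h3 : (j, k) ∈ U <;> by_cases h4 : (6, l) ∈ U <;> simp_all
  have hall : ∀ x ∈ sorouIndex, (x ∈ U ↔ (0, 0) ∈ U) := by
    rintro ⟨j, k⟩ hx
    rcases mem_sorouIndex.1 hx with ⟨hj, hk⟩ | ⟨rfl, hk, hk'⟩
    · exact (key hj hk le_rfl (by norm_num)).trans
        (key (by norm_num) (by norm_num) le_rfl (by norm_num)).symm
    · exact (key (by norm_num) (by norm_num) hk hk').symm
  by_cases h0 : (0, 0) ∈ U
  · exact Or.inr (hU.antisymm fun x hx => (hall x hx).2 h0)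
  · exact Or.inl (Finset.eq_empty_of_forall_notMem fun x hx => h0 ((hall x (hU hx)).1 hx))

lemma isMinVanishing_stmt16Sorou : IsMinVanishing stmt16Sorou := by
  refine ⟨sum_stmt16Sorou, fun g hg hg0 hgne hsum => ?_⟩
  have hgn : g.Nodup := Multiset.nodup_of_le hg nodup_stmt16Sorou
  rw [stmt16Sorou_eq_map] at hg hgne
  have hsub : (⟨g, hgn⟩ : Finset ℂ) ⊆ sorouIndex.image sorouTerm := fun z hz => by
    simpa using Multiset.mem_of_le hg hz
  obtain ⟨U, hU, hUg⟩ := Finset.subset_image_iff.1 hsub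
  have hgU : g = U.val.map sorouTerm := by
    rw [← Finset.image_val_of_injOn (sorouTerm_injOn.mono hU), hUg]
  subst hgU
  rcases eq_empty_or_eq_sorouIndex (by exact_mod_cast hU) hsum with rfl | rfl
  · exact hg0 rfl
  · exact hgne rfl

lemma isRootOfUnity_sorouTerm (x : ℕ × ℕ) : IsRootOfUnity (sorouTerm x) := by
  have h7 := (isPrimitiveRoot_nu (n := 7) (by norm_num)).pow_eq_one
  have h5 := (isPrimitiveRoot_nu (n := 5) (by norm_num)).pow_eq_one
  have hs : (sorouSign x : ℂ) ^ 2 = 1 := by unfold sorouSign; split_ifs <;> norm_num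
  refine ⟨70, by norm_num, ?_⟩
  calc sorouTerm x ^ 70
      = ((sorouSign x : ℂ) ^ 2) ^ 35 * (((nu 7 ^ 7) ^ x.1) ^ 10 * ((nu 5 ^ 5) ^ x.2) ^ 14) := by
        unfold sorouTerm; ring
    _ = 1 := by simp [hs, h7, h5]

lemma isSorou_stmt16Sorou : IsSorou stmt16Sorou := by
  rw [stmt16Sorou_eq_map]
  refine ⟨fun h => ?_, fun z hz => ?_⟩
  · exact absurd (congrArg Multiset.card h) (by rw [Multiset.card_map]; decide)
  · obtain ⟨x, -, rfl⟩ := Multiset.mem_map.1 hz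
    exact isRootOfUnity_sorouTerm x

theorem stmt_16 :
    IsSorou stmt16Sorou ∧ IsMinVanishing stmt16Sorou ∧
    Multiset.card stmt16Sorou = 15 ∧ ∀ z : ℂ, stmt16Sorou.count z ≤ 1 := by
  refine ⟨isSorou_stmt16Sorou, isMinVanishing_stmt16Sorou, ?_,
    Multiset.nodup_iff_count_le_one.1 nodup_stmt16Sorou⟩
  rw [stmt16Sorou_eq_map, Multiset.card_map]
  rfl
end

section
/- The coefficient of x^7 in the 105th cyclotomic polynomial Φ_105 equals −2, while for every positive integer n < 105, every coefficient of the cyclotomic polynomial Φ_n lies in {−1, 0, 1}; thus Φ_105 is the cyclotomic polynomial of least index having a coefficient different from 0, 1, and −1. -/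
open Polynomial

/-- A polynomial is flat if all of its coefficients are `-1`, `0` or `1`. -/
def Polynomial.IsFlat (f : ℤ[X]) : Prop :=
  ∀ k, f.coeff k ∈ ({-1, 0, 1} : Set ℤ)

namespace Polynomial

theorem IsFlat.expand {f : ℤ[X]} (hf : f.IsFlat) {p : ℕ} (hp : 0 < p) :
    (expand ℤ p f).IsFlat := by
  intro k
  rw [coeff_expand hp]
  split_ifs
  · exact hf _
  · simp

theorem IsFlat.comp_neg_X {f : ℤ[X]} (hf : f.IsFlat) : (f.comp (-X)).IsFlat := by
  intro k
  have hX : (-X : ℤ[X]) = C (-1) * X := by simp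
  rw [hX, comp_C_mul_X_coeff]
  have := hf k
  rcases neg_one_pow_eq_or ℤ k with h | h
  · simp_all
  · simp_all
    omega

theorem IsFlat.neg_one_pow_mul {f : ℤ[X]} (hf : f.IsFlat) (d : ℕ) :
    ((-1) ^ d * f).IsFlat := by
  intro k
  have := hf k
  rcases neg_one_pow_eq_or ℤ[X] d with h | h
  · simp_all
  · simp_all
    omega

theorem cyclotomic_two_mul_of_odd {m : ℕ} (hm : Odd m) :
    cyclotomic (2 * m) ℤ = (-1) ^ m.totient * (cyclotomic m ℤ).comp (-X) := by
  have hpos : 0 < m := hm.pos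
  obtain ⟨ξ, hξ⟩ : ∃ ξ : ℂ, IsPrimitiveRoot ξ m :=
    ⟨_, Complex.isPrimitiveRoot_exp m hpos.ne'⟩
  have hneg : IsPrimitiveRoot (-ξ) (2 * m) := by
    have h2 : orderOf (-1 : ℂ) = 2 := by simp [orderOf_neg_one]
    have h := (Commute.all (-1 : ℂ) ξ).orderOf_mul_eq_mul_orderOf_of_coprime
      (by rw [h2, ← hξ.eq_orderOf]; exact hm.coprime_two_left)
    rw [h2, ← hξ.eq_orderOf, neg_one_mul] at h
    exact h ▸ IsPrimitiveRoot.orderOf _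
  apply map_injective (Int.castRingHom ℚ) Int.cast_injective
  have h := minpoly.neg (A := ℚ) ξ
  rw [← cyclotomic_eq_minpoly_rat hneg (by positivity), ← cyclotomic_eq_minpoly_rat hξ hpos,
    natDegree_cyclotomic] at h
  simpa [Polynomial.map_comp] using h

theorem isFlat_cyclotomic_prime {p : ℕ} (hp : p.Prime) : (cyclotomic p ℤ).IsFlat := by
  have := Fact.mk hp
  intro k
  rw [cyclotomic_prime]
  by_cases h : k < p <;> simp [coeff_X_pow, h]

theorem cyclotomic_mul_prime_mul {p q : ℕ} (hp : p.Prime) (hq : q.Prime) (hpq : p ≠ q) :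
    cyclotomic (p * q) ℤ * ((X ^ p - 1) * (X ^ q - 1)) = (X ^ (p * q) - 1) * (X - 1) := by
  have := Fact.mk hp
  have h₁ := cyclotomic_expand_eq_cyclotomic_mul hq
    (fun h ↦ hpq ((Nat.prime_dvd_prime_iff_eq hq hp).1 h).symm) ℤ
  have h₂ := cyclotomic_prime_mul_X_sub_one ℤ p
  have h₃ := congr_arg (expand ℤ q) h₂
  simp only [map_mul, map_sub, map_pow, expand_X, map_one, ← pow_mul] at h₃
  rw [mul_comm p q, ← h₂, ← h₃, h₁, mul_comm p q]
  ring

/-- The key point: a natural number is `p * i + q * j` with `i < q`, `j < p` in at most one way. -/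
theorem coeff_geom_sum_mul_geom_sum {p q : ℕ} (h : p.Coprime q) (k : ℕ) :
    ((∑ i ∈ Finset.range q, (X ^ p) ^ i) * ∑ j ∈ Finset.range p, (X ^ q) ^ j : ℤ[X]).coeff k
      ∈ ({0, 1} : Set ℤ) := by
  have hcard : (((Finset.range q) ×ˢ (Finset.range p)).filter
      fun x ↦ k = p * x.1 + q * x.2).card ≤ 1 := by
    rw [Finset.card_le_one]
    rintro ⟨i, j⟩ hij ⟨i', j'⟩ hij'
    simp only [Finset.mem_filter, Finset.mem_product, Finset.mem_range] at hij hij'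
    obtain ⟨⟨hi, hj⟩, e⟩ := hij
    obtain ⟨⟨hi', hj'⟩, e'⟩ := hij'
    have hi_mod : i ≡ i' [MOD q] := by
      refine Nat.ModEq.cancel_left_of_coprime (c := p) h.symm ?_
      have : p * i + q * j ≡ p * i' + q * j' [MOD q] := by rw [← e, ← e']
      simpa [Nat.ModEq] using this
    have hii : i = i' := hi_mod.eq_of_lt_of_lt hi hi'
    subst hii
    have hjj : j = j' := Nat.eq_of_mul_eq_mul_left (by omega : 0 < q) (by omega)
    rw [hjj]
  rw [Finset.sum_mul_sum, ← Finset.sum_product']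
  simp only [← pow_mul, ← pow_add, finsetSum_coeff, coeff_X_pow, Finset.sum_boole]
  have : ∀ n : ℕ, n ≤ 1 → (n : ℤ) ∈ ({0, 1} : Set ℤ) := by
    intro n hn
    interval_cases n <;> simp
  exact this _ hcard

theorem isFlat_cyclotomic_prime_mul_prime {p q : ℕ} (hp : p.Prime) (hq : q.Prime) (hpq : p ≠ q) :
    (cyclotomic (p * q) ℤ).IsFlat := by
  intro k
  have hpos : 0 < p * q := Nat.mul_pos hp.pos hq.pos
  rcases le_or_gt (p * q) k with hk | hk
  · rw [coeff_eq_zero_of_natDegree_lt]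
    · simp
    · rw [natDegree_cyclotomic]
      exact (Nat.totient_lt _ (Nat.one_lt_mul_iff.2 ⟨hp.pos, hq.pos, .inl hp.one_lt⟩)).trans_le hk
  set F : ℤ[X] := (∑ i ∈ Finset.range q, (X ^ p) ^ i) * ∑ j ∈ Finset.range p, (X ^ q) ^ j
    with hF
  have hflat := coeff_geom_sum_mul_geom_sum ((Nat.coprime_primes hp hq).2 hpq)
  rw [← hF] at hflat
  have key : cyclotomic (p * q) ℤ * (X ^ (p * q) - 1) = F * (X - 1) := by
    have hne : (X ^ (p * q) - 1 : ℤ[X]) ≠ 0 := X_pow_sub_C_ne_zero hpos 1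
    apply mul_right_cancel₀ hne
    have h₁ := geom_sum_mul (X ^ p : ℤ[X]) q
    have h₂ := geom_sum_mul (X ^ q : ℤ[X]) p
    rw [← pow_mul] at h₁ h₂
    rw [mul_comm q p] at h₂
    calc _ = cyclotomic (p * q) ℤ * ((X ^ p - 1) * (X ^ q - 1)) * F := by
          rw [hF]; nth_rw 1 [← h₁]; rw [← h₂]; ring
      _ = _ := by rw [cyclotomic_mul_prime_mul hp hq hpq]; ring
  have hcoeff := congr_arg (coeff · k) key
  simp only [mul_sub, mul_one, coeff_sub, coeff_mul_X_pow', if_neg hk.not_ge] at hcoeff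
  have hk₀ := hflat k
  cases k with
  | zero => simp_all
  | succ k =>
    rw [coeff_mul_X] at hcoeff
    have hk₁ := hflat k
    simp only [Set.mem_insert_iff, Set.mem_singleton_iff] at *
    omega

/-- An odd squarefree number below `105 = 3 * 5 * 7` has at most two prime factors. -/
theorem _root_.Nat.eq_one_or_prime_or_prime_mul_prime_of_lt {n : ℕ} (hn : Squarefree n)
    (hodd : Odd n) (hlt : n < 105) :
    n = 1 ∨ n.Prime ∨ ∃ p q, p.Prime ∧ q.Prime ∧ p ≠ q ∧ n = p * q := by
  by_cases h1 : n = 1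
  · exact .inl h1
  have hp := Nat.minFac_prime h1
  obtain ⟨m, hm⟩ := n.minFac_dvd
  generalize hpn : n.minFac = p at hp hm
  by_cases hm1 : m = 1
  · exact .inr (.inl (by simpa [hm, hm1] using hp))
  have hq := Nat.minFac_prime hm1
  obtain ⟨r, hr⟩ := m.minFac_dvd
  generalize hqm : m.minFac = q at hq hr
  subst hr hm
  have hpq : p < q := by
    refine lt_of_le_of_ne (hpn ▸ Nat.minFac_le_of_dvd hq.two_le ⟨p * r, by ring⟩) ?_
    rintro rfl
    exact hp.not_isUnit (hn p ⟨r, by ring⟩)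
  by_cases hr1 : r = 1
  · exact .inr (.inr ⟨p, q, hp, hq, hpq.ne, by rw [hr1, mul_one]⟩)
  exfalso
  have hs := Nat.minFac_prime hr1
  obtain ⟨t, ht⟩ := r.minFac_dvd
  generalize r.minFac = s at hs ht
  subst ht
  have hqs : q < s := by
    refine lt_of_le_of_ne (hqm ▸ Nat.minFac_le_of_dvd hs.two_le ⟨q * t, by ring⟩) ?_
    rintro rfl
    exact hq.not_isUnit (hn q ⟨p * t, by ring⟩)
  simp only [Nat.odd_mul] at hodd
  obtain ⟨⟨a, rfl⟩, ⟨b, rfl⟩, ⟨c, rfl⟩, ⟨d, rfl⟩⟩ := hodd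
  have ha := hp.two_le
  have h3 : 3 ≤ 2 * a + 1 := by omega
  have h5 : 5 ≤ 2 * b + 1 := by omega
  have h7 : 7 ≤ (2 * c + 1) * (2 * d + 1) :=
    (by omega : 7 ≤ 2 * c + 1).trans (Nat.le_mul_of_pos_right _ (by omega))
  have := Nat.mul_le_mul h3 (Nat.mul_le_mul h5 h7)
  omega

theorem isFlat_cyclotomic_of_lt {n : ℕ} (hpos : 0 < n) (hlt : n < 105) :
    (cyclotomic n ℤ).IsFlat := by
  induction n using Nat.strong_induction_on with
  | _ n ih =>
  by_cases hsq : Squarefree n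
  · rcases n.even_or_odd' with ⟨m, rfl | hodd⟩
    · have hm : Odd m := by
        rw [← Nat.not_even_iff_odd]
        rintro ⟨t, rfl⟩
        exact Nat.prime_two.not_isUnit (hsq 2 ⟨t, by ring⟩)
      rw [cyclotomic_two_mul_of_odd hm]
      exact (ih m (by omega) (by omega) (by omega)).comp_neg_X.neg_one_pow_mul _
    · rcases Nat.eq_one_or_prime_or_prime_mul_prime_of_lt hsq ⟨m, hodd⟩ hlt with
        rfl | hp | ⟨p, q, hp, hq, hpq, rfl⟩
      · intro k
        rw [cyclotomic_one, coeff_sub, coeff_X, coeff_one]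
        split_ifs <;> simp
      · exact isFlat_cyclotomic_prime hp
      · exact isFlat_cyclotomic_prime_mul_prime hp hq hpq
  · obtain ⟨p, hp, t, rfl⟩ : ∃ p, p.Prime ∧ p * p ∣ n := by
      rw [Nat.squarefree_iff_prime_squarefree] at hsq
      push Not at hsq
      exact hsq
    have hpt : 0 < p * t := by
      rw [mul_assoc] at hpos
      exact Nat.pos_of_mul_pos_left hpos
    have hmul : p * p * t = p * t * p := by ring
    have hlt' : p * t < p * p * t := by
      rw [hmul]
      exact lt_mul_of_one_lt_right hpt hp.one_lt
    rw [hmul, ← cyclotomic_expand_eq_cyclotomic hp (dvd_mul_right p t)]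
    exact (ih (p * t) hlt' hpt (hlt'.trans hlt)).expand hp.pos

theorem cyclotomic_fifteen :
    cyclotomic 15 ℤ = X ^ 8 - X ^ 7 + X ^ 5 - X ^ 4 + X ^ 3 - X + 1 := by
  have h := cyclotomic_expand_eq_cyclotomic_mul (n := 3) Nat.prime_five (by norm_num) ℤ
  apply mul_right_cancel₀ (cyclotomic_ne_zero 3 ℤ)
  rw [← h, cyclotomic_three]
  simp only [map_add, map_pow, expand_X, map_one]
  ring

theorem coeff_cyclotomic_hundred_five : (cyclotomic 105 ℤ).coeff 7 = -2 := by
  have h := cyclotomic_expand_eq_cyclotomic_mul (n := 15) (p := 7) (by norm_num) (by norm_num) ℤ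
  have hc (k : ℕ) := congr_arg (coeff · k) h
  simp only [coeff_expand (show 0 < 7 by norm_num), cyclotomic_fifteen, Nat.reduceMul] at hc
  simp only [coeff_mul, Finset.Nat.sum_antidiagonal_eq_sum_range_succ_mk] at hc
  have h0 := hc 0
  have h1 := hc 1
  have h2 := hc 2
  have h3 := hc 3
  have h4 := hc 4
  have h5 := hc 5
  have h6 := hc 6
  have h7 := hc 7
  simp [Finset.sum_range_succ, coeff_X, coeff_one, coeff_X_pow] at h0 h1 h2 h3 h4 h5 h6 h7
  linarith

end Polynomial

theorem stmt_19 :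
    (Polynomial.cyclotomic 105 ℤ).coeff 7 = -2 ∧
    ∀ n : ℕ, 0 < n → n < 105 →
      ∀ k : ℕ, (Polynomial.cyclotomic n ℤ).coeff k ∈ ({-1, 0, 1} : Set ℤ) :=
  ⟨coeff_cyclotomic_hundred_five, fun _ hpos hlt ↦ isFlat_cyclotomic_of_lt hpos hlt⟩
end
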